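/- arXiv:math/0502354 — 2 statements merged into one kernel-verified Lean document; each statement's English description precedes it below -/
import Mathlib

section
/- Let U ⊊ ℂ be a simply connected domain containing 0, and let V ⊊ U be a simply connected proper subdomain of U containing 0. Let ε > 0 and assume that the boundary of V is contained in the open ε-neighborhood of the boundary of U. Then 0 < r(U,0) − r(V,0) ≤ 4·√(r(U,0))·√ε. -/
open Set Filter Topology Metric

theorem not_eventually_eq_of_injOn {f : ℂ → ℂ} {S : Set ℂ} {z : ℂ} (hS : IsOpen S)
    (hi : InjOn f S) (hz : z ∈ S) : ¬ ∀ᶠ w in 𝓝 z, f w = f z := by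
  intro h
  have h1 : ∀ᶠ w in 𝓝[≠] z, w = z := by
    filter_upwards [nhdsWithin_le_nhds h, nhdsWithin_le_nhds (hS.mem_nhds hz)] with w hw hwS
    exact hi hwS hz hw
  obtain ⟨w, hw, hwz⟩ := (h1.and self_mem_nhdsWithin).exists
  exact hwz hw

theorem nhds_le_map_nhds_of_injOn {f : ℂ → ℂ} {S : Set ℂ} {z : ℂ} (hS : IsOpen S)
    (hd : DifferentiableOn ℂ f S) (hi : InjOn f S) (hz : z ∈ S) : 𝓝 (f z) ≤ map f (𝓝 z) :=
  (hd.analyticAt (hS.mem_nhds hz)).eventually_constant_or_nhds_le_map_nhds.resolve_left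
    (not_eventually_eq_of_injOn hS hi hz)

theorem isOpen_image_of_injOn {f : ℂ → ℂ} {S : Set ℂ} (hS : IsOpen S)
    (hd : DifferentiableOn ℂ f S) (hi : InjOn f S) : IsOpen (f '' S) := by
  rw [isOpen_iff_mem_nhds]
  rintro _ ⟨z, hz, rfl⟩
  exact nhds_le_map_nhds_of_injOn hS hd hi hz (image_mem_map (hS.mem_nhds hz))

/-- The inverse of an injective holomorphic function is holomorphic. -/
theorem exists_differentiableOn_inverse {f : ℂ → ℂ} {S : Set ℂ} (hS : IsOpen S)
    (hd : DifferentiableOn ℂ f S) (hi : InjOn f S) :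
    ∃ g : ℂ → ℂ, DifferentiableOn ℂ g (f '' S) ∧ ∀ z ∈ S, g (f z) = z := by
  set g := Function.invFunOn f S
  have hg : ∀ z ∈ S, g (f z) = z := fun z hz => hi.leftInvOn_invFunOn hz
  have hopen := isOpen_image_of_injOn hS hd hi
  have hcont : ∀ z ∈ S, ContinuousAt g (f z) := by
    intro z hz
    rw [ContinuousAt, hg z hz]
    refine Tendsto.mono_left ?_ (nhds_le_map_nhds_of_injOn hS hd hi hz)
    rw [tendsto_map'_iff]
    refine tendsto_id.congr' ?_
    filter_upwards [hS.mem_nhds hz] with w hw using (hg w hw).symm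
  have hfg : ∀ w ∈ f '' S, f (g w) = w := by
    rintro _ ⟨z, hz, rfl⟩
    rw [hg z hz]
  refine ⟨g, ?_, hg⟩
  rintro _ ⟨z, hz, rfl⟩
  refine (Complex.analyticAt_of_differentiable_on_punctured_nhds_of_continuousAt ?_
    (hcont z hz)).differentiableAt.differentiableWithinAt
  have hA : AnalyticAt ℂ f z := hd.analyticAt (hS.mem_nhds hz)
  have hne : ∀ᶠ w in 𝓝[≠] z, deriv f w ≠ 0 := by
    refine hA.deriv.eventually_eq_zero_or_eventually_ne_zero.resolve_left fun h => ?_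
    refine not_eventually_eq_of_injOn hS hi hz ?_
    obtain ⟨r, hr, hrS⟩ := Metric.eventually_nhds_iff_ball.1
      (h.and (hS.eventually_mem hz))
    filter_upwards [ball_mem_nhds z hr] with w hw
    refine (convex_ball z r).is_const_of_fderivWithin_eq_zero (𝕜 := ℂ)
      (hd.mono fun x hx => (hrS x hx).2) ?_ hw (mem_ball_self hr)
    intro x hx
    rw [fderivWithin_of_isOpen isOpen_ball hx]
    ext
    simpa using (hrS x hx).1
  have ht : Tendsto g (𝓝[≠] (f z)) (𝓝[≠] z) := by
    refine tendsto_nhdsWithin_iff.2 ⟨?_, ?_⟩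
    · have := (hcont z hz).tendsto
      rw [hg z hz] at this
      exact this.mono_left nhdsWithin_le_nhds
    · filter_upwards [self_mem_nhdsWithin,
        nhdsWithin_le_nhds (hopen.mem_nhds (mem_image_of_mem f hz))] with w hw hwS hgw
      apply hw
      rw [mem_singleton_iff] at hgw ⊢
      rw [← hgw, hfg w hwS]
  filter_upwards [ht.eventually hne,
    nhdsWithin_le_nhds (hopen.mem_nhds (mem_image_of_mem f hz))] with w hw hwS
  obtain ⟨x, hx, rfl⟩ := hwS
  refine (HasDerivAt.of_local_left_inverse (f := f) (hcont x hx)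
    (f' := deriv f x) ?_ ?_ ?_).differentiableAt
  · rw [hg x hx]
    exact (hd.differentiableAt (hS.mem_nhds hx)).hasDerivAt
  · rwa [hg x hx] at hw
  · filter_upwards [hopen.mem_nhds (mem_image_of_mem f hx)] with y hy using hfg y hy

theorem hasDerivAt_inverse_of_injOn {f g : ℂ → ℂ} {S : Set ℂ} {z : ℂ} (hS : IsOpen S)
    (hd : DifferentiableOn ℂ f S) (hi : InjOn f S) (hg : DifferentiableOn ℂ g (f '' S))
    (hgf : ∀ z ∈ S, g (f z) = z) (hz : z ∈ S) (hne : deriv f z ≠ 0) :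
    HasDerivAt g (deriv f z)⁻¹ (f z) := by
  have him : f '' S ∈ 𝓝 (f z) :=
    (isOpen_image_of_injOn hS hd hi).mem_nhds (mem_image_of_mem f hz)
  refine HasDerivAt.of_local_left_inverse (f := f)
    (hg.differentiableAt him).continuousAt ?_ hne ?_
  · rw [hgf z hz]
    exact (hd.differentiableAt (hS.mem_nhds hz)).hasDerivAt
  · filter_upwards [him] with w hw
    obtain ⟨z, hz, rfl⟩ := hw
    rw [hgf z hz]

open MeasureTheory in
theorem lintegral_norm_mem_eq_lintegral_circleMap {g : ℂ → ENNReal} {J : Set ℝ}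
    (hJ : MeasurableSet J) (hJ0 : J ⊆ Ioi 0)
    (hg : Measurable ({z : ℂ | ‖z‖ ∈ J}.indicator g)) :
    ∫⁻ z in {z : ℂ | ‖z‖ ∈ J}, g z =
      ∫⁻ ρ in J, ENNReal.ofReal ρ * ∫⁻ θ in Ioo (-Real.pi) Real.pi, g (circleMap 0 ρ θ) := by
  have hA : MeasurableSet {z : ℂ | ‖z‖ ∈ J} := measurable_norm hJ
  have hpol : ∀ p : ℝ × ℝ, Complex.polarCoord.symm p = circleMap 0 p.1 p.2 := by
    intro p
    simp [circleMap, Complex.exp_mul_I]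
  have hmeas : Measurable fun p : ℝ × ℝ => circleMap 0 p.1 p.2 := by
    unfold circleMap
    fun_prop
  have key : ∀ p ∈ Ioi (0 : ℝ) ×ˢ Ioo (-Real.pi) Real.pi,
      ENNReal.ofReal p.1 • {z : ℂ | ‖z‖ ∈ J}.indicator g (Complex.polarCoord.symm p)
        = J.indicator (fun ρ => ENNReal.ofReal ρ) p.1 *
            {z : ℂ | ‖z‖ ∈ J}.indicator g (circleMap 0 p.1 p.2) := by
    rintro ⟨ρ, θ⟩ ⟨hρ, -⟩
    rw [hpol]
    by_cases h : ρ ∈ J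
    · simp [h]
    · simp [h, indicator, abs_of_pos (show 0 < ρ from hρ)]
  rw [← lintegral_indicator hA, ← Complex.lintegral_comp_polarCoord_symm,
    polarCoord_target, setLIntegral_congr_fun (measurableSet_Ioi.prod measurableSet_Ioo) key,
    Measure.volume_eq_prod, ← Measure.prod_restrict, lintegral_prod]
  · have h2 : ∀ ρ ∈ Ioi (0:ℝ),
        (∫⁻ θ in Ioo (-Real.pi) Real.pi, J.indicator (fun ρ => ENNReal.ofReal ρ) ρ *
        {z : ℂ | ‖z‖ ∈ J}.indicator g (circleMap 0 ρ θ)) =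
        J.indicator (fun ρ => ENNReal.ofReal ρ *
          ∫⁻ θ in Ioo (-Real.pi) Real.pi, g (circleMap 0 ρ θ)) ρ := by
      intro ρ hρ
      by_cases h : ρ ∈ J
      · simp only [indicator_of_mem h]
        rw [lintegral_const_mul']
        · simp [indicator, abs_of_pos (show 0 < ρ from hρ), h]
        · exact ENNReal.ofReal_ne_top
      · simp [h]
    rw [setLIntegral_congr_fun measurableSet_Ioi h2, lintegral_indicator hJ,
      Measure.restrict_restrict hJ, inter_eq_left.2 hJ0]
  · refine Measurable.aemeasurable (Measurable.mul ?_ (hg.comp hmeas))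
    exact (Measurable.indicator (by fun_prop) hJ).comp measurable_fst

open MeasureTheory in
theorem lintegral_ofReal_div_Ioo {a b k : ℝ} (ha : 0 < a) (hab : a ≤ b) (hk : 0 ≤ k) :
    ∫⁻ ρ in Ioo a b, ENNReal.ofReal (k / ρ) = ENNReal.ofReal (k * Real.log (b / a)) := by
  have h0 : (0 : ℝ) ∉ uIcc a b := by
    rw [uIcc_of_le hab]
    exact fun h => ha.not_ge h.1
  rw [setLIntegral_congr Ioo_ae_eq_Ioc, ← integral_inv h0,
    ← intervalIntegral.integral_const_mul, intervalIntegral.integral_of_le hab,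
    ofReal_integral_eq_lintegral_ofReal]
  · simp [div_eq_mul_inv]
  · have := (intervalIntegral.intervalIntegrable_inv (μ := volume)
      (f := fun x : ℝ => x) (a := a) (b := b)
      (fun x hx h => h0 (h ▸ hx)) continuousOn_id).const_mul k
    exact (intervalIntegrable_iff_integrableOn_Ioc_of_le hab).1 this
  · filter_upwards [ae_restrict_mem measurableSet_Ioc] with x hx
    have : 0 < x := ha.trans hx.1
    positivity

/-- The area of a round annulus with respect to the metric `|dz| / |z|`. -/
theorem lintegral_annulus_inv_norm_sq {a b : ℝ} (ha : 0 < a) (hab : a ≤ b) :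
    ∫⁻ z in {z : ℂ | ‖z‖ ∈ Ioo a b}, ENNReal.ofReal (1 / ‖z‖ ^ 2) =
      ENNReal.ofReal (2 * Real.pi * Real.log (b / a)) := by
  rw [lintegral_norm_mem_eq_lintegral_circleMap measurableSet_Ioo (fun x hx => ha.trans hx.1),
    ← lintegral_ofReal_div_Ioo ha hab (by positivity)]
  · refine MeasureTheory.setLIntegral_congr_fun measurableSet_Ioo fun ρ hρ => ?_
    have hρ0 : 0 < ρ := ha.trans hρ.1
    simp only [norm_circleMap_zero, sq_abs, MeasureTheory.lintegral_const,
      MeasureTheory.Measure.restrict_apply MeasurableSet.univ, univ_inter, Real.volume_Ioo]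
    rw [← ENNReal.ofReal_mul (by positivity), ← ENNReal.ofReal_mul hρ0.le]
    congr 1
    field_simp
    ring
  · exact Measurable.indicator (by fun_prop) (measurable_norm measurableSet_Ioo)

open MeasureTheory in
theorem le_lintegral_annulus_of_differentiableOn {f : ℂ → ℂ} (hf : DifferentiableOn ℂ f (ball 0 1))
    (hf0 : f 0 = 1) {r s : ℝ} (hr : 0 < r) (hrs : r ≤ s) (hs : s ≤ 1) :
    ENNReal.ofReal (2 * Real.pi * Real.log (s / r)) ≤
      ∫⁻ z in {z : ℂ | ‖z‖ ∈ Ioo r s}, ENNReal.ofReal (‖f z‖ ^ 2 / ‖z‖ ^ 2) := by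
  have hsub : {z : ℂ | ‖z‖ ∈ Ioo r s} ⊆ ball 0 1 := fun z hz => by
    simpa using hz.2.trans_le hs
  rw [lintegral_norm_mem_eq_lintegral_circleMap measurableSet_Ioo (fun x hx => hr.trans hx.1),
    ← lintegral_ofReal_div_Ioo hr hrs (by positivity)]
  · refine setLIntegral_mono' measurableSet_Ioo fun ρ hρ => ?_
    have hρ0 : 0 < ρ := hr.trans hρ.1
    have hρ1 : ρ < 1 := hρ.2.trans_le hs
    have hcb : closedBall (0 : ℂ) ρ ⊆ ball 0 1 := closedBall_subset_ball hρ1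
    have hmean : Real.circleAverage f 0 ρ = 1 := by
      rw [← hf0]
      apply DiffContOnCl.circleAverage
      rw [abs_of_pos hρ0]
      exact (hf.mono hcb).diffContOnCl_ball subset_rfl
    have hu : Continuous fun θ => f (circleMap 0 ρ θ) :=
      hf.continuousOn.comp_continuous (continuous_circleMap 0 ρ) fun θ =>
        hcb (circleMap_mem_closedBall 0 hρ0.le θ)
    have hint : ∫ θ in (-Real.pi)..Real.pi, f (circleMap 0 ρ θ) = 2 * Real.pi := by
      have hper : (fun θ ↦ f (circleMap 0 ρ θ)).Periodic (2 * Real.pi) :=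
        fun x ↦ by simp [periodic_circleMap 0 ρ x]
      have h1 := hper.intervalIntegral_add_eq (-Real.pi) 0
      rw [show -Real.pi + 2 * Real.pi = Real.pi by ring, zero_add] at h1
      rw [h1]
      rw [Real.circleAverage_def, inv_smul_eq_iff₀ (by positivity)] at hmean
      simpa using hmean
    have hre : ∫ θ in (-Real.pi)..Real.pi, (f (circleMap 0 ρ θ)).re = 2 * Real.pi := by
      have := intervalIntegral.intervalIntegral_re
        (hu.intervalIntegrable (μ := volume) (-Real.pi) Real.pi)
      simp only [RCLike.re_eq_complex_re] at this
      rw [this, hint]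
      simp
    have hpi : -Real.pi ≤ Real.pi := by linarith [Real.pi_pos]
    have hsq : 2 * Real.pi ≤ ∫ θ in (-Real.pi)..Real.pi, ‖f (circleMap 0 ρ θ)‖ ^ 2 := by
      calc 2 * Real.pi = ∫ θ in (-Real.pi)..Real.pi, (2 * (f (circleMap 0 ρ θ)).re - 1) := by
            rw [intervalIntegral.integral_sub, intervalIntegral.integral_const_mul, hre]
            · simp
              ring
            · exact (continuous_const.mul (Complex.continuous_re.comp hu)).intervalIntegrable _ _
            · exact intervalIntegrable_const
        _ ≤ _ := by
            refine intervalIntegral.integral_mono_on hpi ?_ ?_ fun θ _ => ?_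
            · exact ((continuous_const.mul (Complex.continuous_re.comp hu)).sub
                continuous_const).intervalIntegrable _ _
            · exact (hu.norm.pow 2).intervalIntegrable _ _
            · rw [← Complex.normSq_eq_norm_sq, Complex.normSq_apply]
              nlinarith [sq_nonneg ((f (circleMap 0 ρ θ)).re - 1),
                sq_nonneg (f (circleMap 0 ρ θ)).im]
    simp only [norm_circleMap_zero, sq_abs]
    rw [setLIntegral_congr Ioo_ae_eq_Ioc, ← ofReal_integral_eq_lintegral_ofReal,
      ← ENNReal.ofReal_mul hρ0.le, ← intervalIntegral.integral_of_le hpi,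
      intervalIntegral.integral_div]
    · refine ENNReal.ofReal_le_ofReal ?_
      rw [div_le_iff₀ hρ0]
      field_simp
      exact hsq
    · exact (intervalIntegrable_iff_integrableOn_Ioc_of_le hpi).1
        (((hu.norm.pow 2).div_const _).intervalIntegrable _ _)
    · exact ae_of_all _ fun θ => by positivity
  · rw [← piecewise_eq_indicator]
    refine ContinuousOn.measurable_piecewise ?_ continuousOn_const
      (measurable_norm measurableSet_Ioo)
    refine ENNReal.continuous_ofReal.comp_continuousOn ?_
    refine ((hf.continuousOn.mono hsub).norm.pow 2).div (continuous_norm.pow 2).continuousOn ?_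
    intro z hz
    have : 0 < ‖z‖ := hr.trans hz.1
    positivity

open MeasureTheory in
theorem lintegral_image_eq_lintegral_norm_deriv_sq {f : ℂ → ℂ} {S A : Set ℂ} (hS : IsOpen S)
    (hd : DifferentiableOn ℂ f S) (hA : MeasurableSet A) (hAS : A ⊆ S) (hi : InjOn f A)
    (g : ℂ → ENNReal) :
    ∫⁻ w in f '' A, g w = ∫⁻ z in A, ENNReal.ofReal (‖deriv f z‖ ^ 2) * g (f z) := by
  have h : ∀ z ∈ A, HasFDerivWithinAt f
      ((ContinuousLinearMap.toSpanSingleton ℂ (deriv f z)).restrictScalars ℝ) A z :=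
    fun z hz => ((hd.differentiableAt (hS.mem_nhds (hAS hz))).hasDerivAt.hasFDerivAt.restrictScalars
      ℝ).hasFDerivWithinAt
  rw [lintegral_image_eq_lintegral_abs_det_fderiv_mul volume hA h hi]
  refine setLIntegral_congr_fun hA fun z _ => ?_
  congr 2
  simp [ContinuousLinearMap.det, LinearMap.det_restrictScalars, Algebra.norm_complex_eq,
    Complex.normSq_eq_norm_sq]

open MeasureTheory in
theorem le_of_closedBall_subset_image {H : ℂ → ℂ} (hd : DifferentiableOn ℂ H (ball 0 1))
    (hi : InjOn H (ball 0 1)) (h0 : H 0 = 0) (hH : ∀ z ∈ ball 0 1, ∀ w ∈ ball 0 1, H z * H w ≠ 1)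
    (hder : deriv H 0 ≠ 0)
    {r c : ℝ} (hr : 0 < r) (hr1 : r < 1) (hc : 0 < c)
    (hsub : closedBall 0 c ⊆ H '' closedBall 0 r) : c ≤ r := by
  have hrb : closedBall (0 : ℂ) r ⊆ ball 0 1 := closedBall_subset_ball hr1
  have h0b : (0 : ℂ) ∈ ball (0 : ℂ) 1 := by simp
  have hne : ∀ z ∈ ball (0 : ℂ) 1, z ≠ 0 → H z ≠ 0 := fun z hz hz0 h =>
    hz0 (hi hz h0b (h.trans h0.symm))
  set A : Set ℂ := {z : ℂ | ‖z‖ ∈ Ioo r 1} with hAdef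
  have hA : MeasurableSet A := measurable_norm measurableSet_Ioo
  have hAb : A ⊆ ball 0 1 := fun z hz => by simpa using hz.2
  have hA0 : ∀ z ∈ A, z ≠ 0 := fun z hz h => by
    have := hz.1
    simp [h] at this
    linarith
  have hAH : ∀ z ∈ A, H z ≠ 0 := fun z hz => hne z (hAb hz) (hA0 z hz)
  have hc1 : c < 1 := by
    by_contra! h
    obtain ⟨z, hz, hz1⟩ := hsub (show (1 : ℂ) ∈ closedBall 0 c by simpa using h)
    exact hH z (hrb hz) z (hrb hz) (by simp [hz1])
  have hcc : c ≤ c⁻¹ := hc1.le.trans ((one_le_inv₀ hc).2 hc1.le)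
  have hlow : ∀ z ∈ A, c < ‖H z‖ := by
    intro z hz
    by_contra! h
    obtain ⟨x, hx, hxz⟩ := hsub (show H z ∈ closedBall 0 c by simpa using h)
    rw [hi (hrb hx) (hAb hz) hxz, mem_closedBall_zero_iff] at hx
    exact hx.not_gt hz.1
  have hupp : ∀ z ∈ A, ‖H z‖ < c⁻¹ := by
    intro z hz
    by_contra! h
    have : (H z)⁻¹ ∈ closedBall (0 : ℂ) c := by
      rw [mem_closedBall_zero_iff, norm_inv]
      exact inv_le_of_inv_le₀ hc h
    obtain ⟨x, hx, hxz⟩ := hsub this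
    exact hH z (hAb hz) x (hrb hx) (by rw [hxz, mul_inv_cancel₀ (hAH z hz)])
  set S : Set ℂ := ball 0 1 \ {0} with hSdef
  have hS : IsOpen S := isOpen_ball.sdiff isClosed_singleton
  have hAS : A ⊆ S := fun z hz => ⟨hAb hz, hA0 z hz⟩
  have hdS : DifferentiableOn ℂ H S := hd.mono sdiff_subset
  have hdS' : DifferentiableOn ℂ (fun z => (H z)⁻¹) S := hdS.inv fun z hz => hne z hz.1 hz.2
  have hiA : InjOn H A := hi.mono hAb
  have hiA' : InjOn (fun z => (H z)⁻¹) A := fun x hx y hy hxy => hiA hx hy (inv_injective hxy)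
  have hm' : MeasurableSet ((fun z => (H z)⁻¹) '' A) :=
    hA.image_of_continuousOn_injOn (hdS'.continuousOn.mono hAS) hiA'
  have hdisj : Disjoint (H '' A) ((fun z => (H z)⁻¹) '' A) := by
    rw [Set.disjoint_left]
    rintro _ ⟨z, hz, rfl⟩ ⟨w, hw, hwz⟩
    refine hH z (hAb hz) w (hAb hw) ?_
    simp only at hwz
    rw [← hwz, inv_mul_cancel₀ (hAH w hw)]
  set f : ℂ → ℂ := fun z => deriv H z / dslope H 0 z with hfdef
  have hf0 : f 0 = 1 := by simp [hfdef, hder]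
  have hfd : DifferentiableOn ℂ f (ball 0 1) := by
    refine (hd.deriv isOpen_ball).div
      ((Complex.differentiableOn_dslope (ball_mem_nhds 0 one_pos)).2 hd) fun z hz => ?_
    by_cases hz0 : z = 0
    · simpa [hz0] using hder
    · rw [dslope_of_ne _ hz0, slope_def_field, h0]
      simpa using ⟨hne z hz hz0, hz0⟩
  have hfA : ∀ z ∈ A, ‖f z‖ ^ 2 / ‖z‖ ^ 2 = ‖deriv H z‖ ^ 2 / ‖H z‖ ^ 2 := by
    intro z hz
    have h1 : 0 < ‖z‖ := norm_pos_iff.2 (hA0 z hz)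
    have h2 : 0 < ‖H z‖ := norm_pos_iff.2 (hAH z hz)
    rw [hfdef]
    simp only [dslope_of_ne _ (hA0 z hz), slope_def_field, h0, norm_div, sub_zero]
    field_simp
  have e1 : ∫⁻ w in H '' A, ENNReal.ofReal (1 / ‖w‖ ^ 2) =
      ∫⁻ z in A, ENNReal.ofReal (‖f z‖ ^ 2 / ‖z‖ ^ 2) := by
    rw [lintegral_image_eq_lintegral_norm_deriv_sq hS hdS hA hAS hiA]
    refine setLIntegral_congr_fun hA fun z hz => ?_
    simp only [hfA z hz]
    rw [← ENNReal.ofReal_mul (by positivity), mul_one_div]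
  have e2 : ∫⁻ w in (fun z => (H z)⁻¹) '' A, ENNReal.ofReal (1 / ‖w‖ ^ 2) =
      ∫⁻ z in A, ENNReal.ofReal (‖f z‖ ^ 2 / ‖z‖ ^ 2) := by
    rw [lintegral_image_eq_lintegral_norm_deriv_sq hS hdS' hA hAS hiA']
    refine setLIntegral_congr_fun hA fun z hz => ?_
    have h2 : 0 < ‖H z‖ := norm_pos_iff.2 (hAH z hz)
    have h3 : deriv (fun z => (H z)⁻¹) z = - deriv H z / H z ^ 2 :=
      ((hdS.differentiableAt (hS.mem_nhds (hAS hz))).hasDerivAt.inv (hAH z hz)).deriv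
    simp only [hfA z hz, h3]
    rw [← ENNReal.ofReal_mul (by positivity)]
    congr 1
    simp only [norm_div, norm_neg, norm_pow, norm_inv]
    field_simp
  have hI := le_lintegral_annulus_of_differentiableOn hfd hf0 hr hr1.le le_rfl
  have hT : H '' A ∪ (fun z => (H z)⁻¹) '' A ⊆ {z : ℂ | ‖z‖ ∈ Ioo c c⁻¹} := by
    rintro _ (⟨z, hz, rfl⟩ | ⟨z, hz, rfl⟩)
    · exact ⟨hlow z hz, hupp z hz⟩
    · have h2 : 0 < ‖H z‖ := norm_pos_iff.2 (hAH z hz)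
      simp only [mem_ofPred_eq, norm_inv]
      exact ⟨(lt_inv_comm₀ hc h2).2 (hupp z hz), (inv_lt_inv₀ h2 hc).2 (hlow z hz)⟩
  have hfin : ENNReal.ofReal (2 * Real.pi * Real.log (1 / r)) +
      ENNReal.ofReal (2 * Real.pi * Real.log (1 / r)) ≤
      ENNReal.ofReal (2 * Real.pi * Real.log (c⁻¹ / c)) := by
    rw [← lintegral_annulus_inv_norm_sq hc hcc]
    refine (add_le_add hI hI).trans ?_
    nth_rw 1 [← e1]
    rw [← e2, ← lintegral_union hm' hdisj]
    exact lintegral_mono_set hT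
  have hlr : 0 ≤ Real.log (1 / r) := Real.log_nonneg ((one_le_div hr).2 hr1.le)
  have hlc : 0 ≤ Real.log (c⁻¹ / c) := Real.log_nonneg ((one_le_div hc).2 hcc)
  rw [← ENNReal.ofReal_add (by positivity) (by positivity),
    ENNReal.ofReal_le_ofReal_iff (by positivity)] at hfin
  rw [Real.log_div (inv_ne_zero hc.ne') hc.ne', Real.log_inv, one_div, Real.log_inv] at hfin
  have : Real.log c ≤ Real.log r := by
    nlinarith [Real.pi_pos]
  exact (Real.log_le_log_iff hc hr).1 this

/-- A normalized univalent Bieberbach-Eilenberg function has derivative at most one in modulus at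
the origin. -/
theorem norm_deriv_le_one_of_mul_ne_one {H : ℂ → ℂ} (hd : DifferentiableOn ℂ H (ball 0 1))
    (hi : InjOn H (ball 0 1)) (h0 : H 0 = 0)
    (hH : ∀ z ∈ ball 0 1, ∀ w ∈ ball 0 1, H z * H w ≠ 1) : ‖deriv H 0‖ ≤ 1 := by
  by_contra! h
  have hder : deriv H 0 ≠ 0 := by
    rw [← norm_pos_iff]
    linarith
  have h0b : (0 : ℂ) ∈ ball (0 : ℂ) 1 := by simp
  obtain ⟨K, hKd, hK⟩ := exists_differentiableOn_inverse isOpen_ball hd hi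
  have hopen := isOpen_image_of_injOn isOpen_ball hd hi
  have him : H '' ball 0 1 ∈ 𝓝 (0 : ℂ) := hopen.mem_nhds ⟨0, h0b, h0⟩
  have hK0 : K 0 = 0 := by simpa [h0] using hK 0 h0b
  have hKder : HasDerivAt K (deriv H 0)⁻¹ 0 := by
    simpa [h0] using hasDerivAt_inverse_of_injOn isOpen_ball hd hi hKd hK h0b hder
  obtain ⟨k, hk1, hk2⟩ := exists_between (inv_lt_one_of_one_lt₀ h)
  have hk0 : 0 < k := lt_of_le_of_lt (by positivity) hk1
  have hlit := (hasDerivAt_iff_isLittleO.1 hKder).def (sub_pos.2 hk1)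
  obtain ⟨δ, hδ, hb⟩ := Metric.eventually_nhds_iff_ball.1 (hlit.and him)
  set c := min (δ / 2) (1 / 2)
  have hc : 0 < c := by positivity
  have hcδ : c < δ := lt_of_le_of_lt (min_le_left _ _) (by linarith)
  have hc1 : c ≤ 1 / 2 := min_le_right _ _
  have : c ≤ k * c := by
    refine le_of_closedBall_subset_image hd hi h0 hH hder (by positivity) (by nlinarith) hc ?_
    intro w hw
    obtain ⟨h1, z, hz, rfl⟩ := hb w (closedBall_subset_ball hcδ hw)
    refine ⟨z, ?_, rfl⟩
    rw [mem_closedBall_zero_iff] at hw ⊢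
    simp only [hK z hz, hK0, sub_zero, smul_eq_mul] at h1
    have h2 : ‖z‖ ≤ ‖z - H z * (deriv H 0)⁻¹‖ + ‖H z * (deriv H 0)⁻¹‖ := by
      simpa using norm_add_le (z - H z * (deriv H 0)⁻¹) (H z * (deriv H 0)⁻¹)
    rw [norm_mul, norm_inv] at h2
    nlinarith
  nlinarith

/-- A holomorphic function without zeros on a disk has a holomorphic logarithm. -/
theorem exists_exp_eq_of_ne_zero {F : ℂ → ℂ} (hd : DifferentiableOn ℂ F (ball 0 1))
    (hF : ∀ z ∈ ball 0 1, F z ≠ 0) :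
    ∃ L : ℂ → ℂ, (∀ z ∈ ball 0 1, HasDerivAt L (deriv F z / F z) z) ∧
      ∀ z ∈ ball 0 1, Complex.exp (L z) = F z := by
  obtain ⟨L, hL⟩ := ((hd.deriv isOpen_ball).div hd hF).isExactOn_ball
  have h0b : (0 : ℂ) ∈ ball (0 : ℂ) 1 := by simp
  have hK : ∀ z ∈ ball (0 : ℂ) 1, HasDerivAt (fun z => F z * Complex.exp (-L z)) 0 z := by
    intro z hz
    have h1 : HasDerivAt L (deriv F z / F z) z := hL z hz
    refine ((hd.differentiableAt (isOpen_ball.mem_nhds hz)).hasDerivAt.mul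
      h1.neg.cexp).congr_deriv ?_
    have := hF z hz
    field_simp
    ring
  have hconst : ∀ z ∈ ball (0 : ℂ) 1, F z * Complex.exp (-L z) = F 0 * Complex.exp (-L 0) := by
    intro z hz
    refine (convex_ball (0 : ℂ) 1).is_const_of_fderivWithin_eq_zero (𝕜 := ℂ)
      (fun x hx => (hK x hx).differentiableAt.differentiableWithinAt) ?_ hz h0b
    intro x hx
    rw [fderivWithin_of_isOpen isOpen_ball hx]
    ext
    simpa using (hK x hx).deriv
  refine ⟨fun z => L z - L 0 + Complex.log (F 0), fun z hz => ?_, fun z hz => ?_⟩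
  · exact ((hL z hz).sub_const _).add_const _
  · have h := hconst z hz
    simp only [Complex.exp_neg] at h
    rw [Complex.exp_add, Complex.exp_sub, Complex.exp_log (hF 0 h0b)]
    have := Complex.exp_ne_zero (L z)
    have := Complex.exp_ne_zero (L 0)
    field_simp at h ⊢
    rw [h, mul_comm]

/-- A form of the Koebe one-quarter theorem. -/
theorem norm_deriv_zero_le_four_mul_norm {F : ℂ → ℂ} (hd : DifferentiableOn ℂ F (ball 0 1))
    (hi : InjOn F (ball 0 1)) (hF : ∀ z ∈ ball 0 1, F z ≠ 0) :
    ‖deriv F 0‖ ≤ 4 * ‖F 0‖ := by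
  obtain ⟨L, hL, hLF⟩ := exists_exp_eq_of_ne_zero hd hF
  have h0b : (0 : ℂ) ∈ ball (0 : ℂ) 1 := by simp
  set G : ℂ → ℂ := fun z => Complex.exp (L z / 2) with hGdef
  have hG0 : ∀ z, G z ≠ 0 := fun z => Complex.exp_ne_zero _
  have hG2 : ∀ z ∈ ball (0 : ℂ) 1, G z ^ 2 = F z := fun z hz => by
    rw [← hLF z hz, hGdef]
    simp only
    rw [← Complex.exp_nat_mul]
    congr 1
    push_cast
    ring
  have hGd : ∀ z ∈ ball (0 : ℂ) 1, HasDerivAt G (G z * (deriv F z / F z / 2)) z := fun z hz =>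
    ((hL z hz).div_const 2).cexp
  have hsum : ∀ z ∈ ball (0 : ℂ) 1, ∀ w ∈ ball (0 : ℂ) 1, G z + G w ≠ 0 := by
    intro z hz w hw h
    have h1 : G z = - G w := eq_neg_of_add_eq_zero_left h
    have h2 : z = w := hi hz hw (by rw [← hG2 z hz, ← hG2 w hw, h1, neg_sq])
    subst h2
    apply hG0 z
    linear_combination h / 2
  set H : ℂ → ℂ := fun z => (G z - G 0) / (G z + G 0) with hHdef
  have hHd : ∀ z ∈ ball (0 : ℂ) 1, HasDerivAt H
      ((G z * (deriv F z / F z / 2) * (G z + G 0) - (G z - G 0) * (G z * (deriv F z / F z / 2)))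
        / (G z + G 0) ^ 2) z := fun z hz =>
    ((hGd z hz).sub_const _).div ((hGd z hz).add_const _) (hsum z hz 0 h0b)
  have hH1 : ‖deriv H 0‖ ≤ 1 := by
    refine norm_deriv_le_one_of_mul_ne_one
      (fun z hz => (hHd z hz).differentiableAt.differentiableWithinAt) ?_ (by simp [hHdef]) ?_
    · intro z hz w hw hzw
      simp only [hHdef] at hzw
      rw [div_eq_div_iff (hsum z hz 0 h0b) (hsum w hw 0 h0b)] at hzw
      have h1 : G z = G w := mul_left_cancel₀ (mul_ne_zero two_ne_zero (hG0 0))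
        (by linear_combination hzw)
      exact hi hz hw (by rw [← hG2 z hz, ← hG2 w hw, h1])
    · intro z hz w hw hzw
      simp only [hHdef] at hzw
      rw [div_mul_div_comm,
        div_eq_one_iff_eq (mul_ne_zero (hsum z hz 0 h0b) (hsum w hw 0 h0b))] at hzw
      refine hsum z hz w hw (mul_left_cancel₀ (mul_ne_zero two_ne_zero (hG0 0)) ?_)
      linear_combination -hzw
  have hF0 := hF 0 h0b
  have hval : deriv H 0 = deriv F 0 / (4 * F 0) := by
    rw [(hHd 0 h0b).deriv]
    have := hG0 0
    field_simp
    ring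
  rw [hval, norm_div, norm_mul,
    div_le_one₀ (mul_pos (by simp) (norm_pos_iff.2 hF0))] at hH1
  simpa using hH1

theorem norm_add_lt_norm_one_add_conj_mul {a z : ℂ} (ha : ‖a‖ < 1) (hz : ‖z‖ < 1) :
    ‖z + a‖ < ‖1 + (starRingEnd ℂ) a * z‖ := by
  rw [← sq_lt_sq₀ (norm_nonneg _) (norm_nonneg _)]
  have h1 : ‖a‖ ^ 2 < 1 := by nlinarith [norm_nonneg a]
  have h2 : ‖z‖ ^ 2 < 1 := by nlinarith [norm_nonneg z]
  simp only [← Complex.normSq_eq_norm_sq, Complex.normSq_apply] at *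
  simp
  nlinarith [mul_pos (sub_pos.2 h1) (sub_pos.2 h2)]

theorem norm_deriv_mul_le_four_mul_norm {F : ℂ → ℂ} (hd : DifferentiableOn ℂ F (ball 0 1))
    (hi : InjOn F (ball 0 1)) (hF : ∀ z ∈ ball 0 1, F z ≠ 0) {a : ℂ} (ha : a ∈ ball (0 : ℂ) 1) :
    ‖deriv F a‖ * (1 - ‖a‖ ^ 2) ≤ 4 * ‖F a‖ := by
  have ha1 : ‖a‖ < 1 := by simpa using ha
  have h0b : (0 : ℂ) ∈ ball (0 : ℂ) 1 := by simp
  set b := (starRingEnd ℂ) a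
  have hden : ∀ z ∈ ball (0 : ℂ) 1, 1 + b * z ≠ 0 := fun z hz h => by
    have := norm_add_lt_norm_one_add_conj_mul ha1 (mem_ball_zero_iff.1 hz)
    rw [show (1 + (starRingEnd ℂ) a * z) = 0 from h, norm_zero] at this
    exact this.not_ge (norm_nonneg _)
  set T : ℂ → ℂ := fun z => (z + a) / (1 + b * z) with hTdef
  have hT : MapsTo T (ball 0 1) (ball 0 1) := fun z hz => by
    rw [mem_ball_zero_iff, hTdef, norm_div, div_lt_one (norm_pos_iff.2 (hden z hz))]
    exact norm_add_lt_norm_one_add_conj_mul ha1 (mem_ball_zero_iff.1 hz)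
  have hTd : ∀ z ∈ ball (0 : ℂ) 1, HasDerivAt T
      ((1 * (1 + b * z) - (z + a) * (b * 1)) / (1 + b * z) ^ 2) z := fun z hz =>
    ((hasDerivAt_id z).add_const a).div (((hasDerivAt_id z).const_mul b).const_add 1) (hden z hz)
  have hnb : b * a = (‖a‖ ^ 2 : ℝ) := by
    rw [← Complex.normSq_eq_norm_sq, Complex.normSq_eq_conj_mul_self]
  have hab : 0 < 1 - ‖a‖ ^ 2 := by nlinarith [norm_nonneg a]
  have hTi : InjOn T (ball 0 1) := by
    intro z hz w hw hzw
    simp only [hTdef] at hzw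
    rw [div_eq_div_iff (hden z hz) (hden w hw)] at hzw
    have hne : (1 - (‖a‖ ^ 2 : ℝ) : ℂ) ≠ 0 := by
      exact_mod_cast hab.ne'
    refine mul_left_cancel₀ hne ?_
    rw [← hnb]
    linear_combination hzw
  have hT0 : T 0 = a := by simp [hTdef]
  have key := norm_deriv_zero_le_four_mul_norm (F := F ∘ T)
    (hd.comp (fun z hz => (hTd z hz).differentiableAt.differentiableWithinAt) hT)
    (hi.comp hTi hT) (fun z hz => hF _ (hT hz))
  have hc : HasDerivAt (F ∘ T) (deriv F a * (1 - (‖a‖ ^ 2 : ℝ))) 0 := by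
    have h1 := hTd 0 h0b
    have h2 : HasDerivAt F (deriv F a) (T 0) := by
      rw [hT0]
      exact (hd.differentiableAt (isOpen_ball.mem_nhds ha)).hasDerivAt
    refine (h2.comp 0 h1).congr_deriv ?_
    rw [← hnb]
    simp [mul_comm]
  rw [hc.deriv, Function.comp_apply, hT0, norm_mul] at key
  rwa [← Complex.ofReal_one, ← Complex.ofReal_sub, Complex.norm_of_nonneg hab.le] at key

/-- Lower growth estimate for univalent functions without zeros. -/
theorem le_norm_of_injOn_of_ne_zero {F : ℂ → ℂ} (hd : DifferentiableOn ℂ F (ball 0 1))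
    (hi : InjOn F (ball 0 1)) (hF : ∀ z ∈ ball 0 1, F z ≠ 0) {z : ℂ} (hz : z ∈ ball (0 : ℂ) 1) :
    ‖F 0‖ * ((1 - ‖z‖) / (1 + ‖z‖)) ^ 2 ≤ ‖F z‖ := by
  obtain ⟨L, hL, hLF⟩ := exists_exp_eq_of_ne_zero hd hF
  have h0b : (0 : ℂ) ∈ ball (0 : ℂ) 1 := by simp
  have hz1 : ‖z‖ < 1 := by simpa using hz
  have hz0 := norm_nonneg z
  set r := ‖z‖ with hr
  have htz : ∀ t ∈ Icc (0 : ℝ) 1, (t : ℂ) * z ∈ ball (0 : ℂ) 1 ∧ ‖(t : ℂ) * z‖ = t * r := by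
    intro t ht
    have h : ‖(t : ℂ) * z‖ = t * r := by
      rw [norm_mul, Complex.norm_of_nonneg ht.1]
    refine ⟨?_, h⟩
    rw [mem_ball_zero_iff, h]
    nlinarith [ht.1, ht.2]
  have hder : ∀ t ∈ Icc (0 : ℝ) 1, HasDerivAt (fun t : ℝ => L (t * z) - L 0)
      (deriv F (t * z) / F (t * z) * z) t := by
    intro t ht
    have h1 : HasDerivAt (fun t : ℂ => t * z) z (t : ℂ) := by
      simpa using (hasDerivAt_id (t : ℂ)).mul_const z
    exact (((hL _ (htz t ht).1).comp (t : ℂ) h1).comp_ofReal).sub_const _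
  have hpos : ∀ t ∈ Icc (0 : ℝ) 1, 0 < 1 - t * r ∧ 0 < 1 + t * r := fun t ht =>
    ⟨by nlinarith [ht.1, ht.2], by nlinarith [ht.1, ht.2]⟩
  have hB : ∀ t ∈ Icc (0 : ℝ) 1,
      HasDerivAt (fun t : ℝ => 2 * (Real.log (1 + t * r) - Real.log (1 - t * r)))
        (2 * (r / (1 + t * r) - (-r) / (1 - t * r))) t := by
    intro t ht
    have h1 : HasDerivAt (fun t : ℝ => t * r) r t := by
      simpa using (hasDerivAt_id t).mul_const r
    exact (((h1.const_add 1).log (hpos t ht).2.ne').sub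
      ((h1.const_sub 1).log (hpos t ht).1.ne')).const_mul 2
  have hbound := image_norm_le_of_norm_deriv_right_le_deriv_boundary'
    (fun t ht => (hder t ht).continuousAt.continuousWithinAt)
    (fun t ht => (hder t (Ico_subset_Icc_self ht)).hasDerivWithinAt)
    (B := fun t : ℝ => 2 * (Real.log (1 + t * r) - Real.log (1 - t * r)))
    (by simp)
    (fun t ht => (hB t ht).continuousAt.continuousWithinAt)
    (fun t ht => (hB t (Ico_subset_Icc_self ht)).hasDerivWithinAt)
    (fun t ht => by
      have ht' := Ico_subset_Icc_self ht
      obtain ⟨hb, hn⟩ := htz t ht'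
      obtain ⟨p1, p2⟩ := hpos t ht'
      have hk := norm_deriv_mul_le_four_mul_norm hd hi hF hb
      have hFp : 0 < ‖F (t * z)‖ := norm_pos_iff.2 (hF _ hb)
      rw [hn] at hk
      rw [norm_mul, norm_div, ← hr]
      have e : 2 * (r / (1 + t * r) - (-r) / (1 - t * r)) =
          4 / ((1 - t * r) * (1 + t * r)) * r := by
        rw [div_sub_div _ _ p2.ne' p1.ne', ← mul_div_assoc, div_mul_eq_mul_div,
          div_eq_div_iff (mul_pos p2 p1).ne' (mul_pos p1 p2).ne']
        ring
      rw [e]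
      refine mul_le_mul_of_nonneg_right ?_ hz0
      rw [div_le_div_iff₀ hFp (mul_pos p1 p2)]
      linarith)
    (right_mem_Icc.2 zero_le_one)
  simp only [Complex.ofReal_one, one_mul] at hbound
  have hp : 0 < 1 - r := by linarith
  have hre : (L 0).re - 2 * (Real.log (1 + r) - Real.log (1 - r)) ≤ (L z).re := by
    have := (Complex.abs_re_le_norm (L z - L 0)).trans hbound
    rw [Complex.sub_re] at this
    linarith [(abs_le.1 this).1]
  rw [← hLF z hz, ← hLF 0 h0b, Complex.norm_exp, Complex.norm_exp]
  refine le_trans (le_of_eq ?_) (Real.exp_le_exp.2 hre)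
  rw [Real.exp_sub, ← Real.log_div (by positivity) hp.ne', two_mul, Real.exp_add,
    Real.exp_log (by positivity)]
  field_simp

/-- Lemma `rad-modulus1`: if `V ⊊ U` are simply connected domains containing `0`
(presented via their normalized Riemann maps `φU`, `φV` from the unit disk, so that the
conformal radii are `r(U,0) = deriv φU 0 = rU` and `r(V,0) = deriv φV 0 = rV`), and the
boundary of `V` is contained in the open `ε`-neighborhood of the boundary of `U`, then
`0 < r(U,0) - r(V,0) ≤ 4·√(r(U,0))·√ε`. -/
theorem conformal_radius_perturbation
    (U V : Set ℂ) (ε rU rV : ℝ) (hε : 0 < ε)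
    (φU φV : ℂ → ℂ)
    (hUd : DifferentiableOn ℂ φU (Metric.ball 0 1))
    (hUi : Set.InjOn φU (Metric.ball 0 1))
    (hUim : φU '' Metric.ball 0 1 = U)
    (hU0 : φU 0 = 0) (hUr : deriv φU 0 = (rU : ℂ)) (hrU : 0 < rU)
    (hVd : DifferentiableOn ℂ φV (Metric.ball 0 1))
    (hVi : Set.InjOn φV (Metric.ball 0 1))
    (hVim : φV '' Metric.ball 0 1 = V)
    (hV0 : φV 0 = 0) (hVr : deriv φV 0 = (rV : ℂ)) (hrV : 0 < rV)
    (hVU : V ⊆ U) (hVneU : V ≠ U)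
    (hfr : frontier V ⊆ Metric.thickening ε (frontier U)) :
    0 < rU - rV ∧ rU - rV ≤ 4 * Real.sqrt rU * Real.sqrt ε := by
  obtain ⟨KU, hKUd, hKU⟩ := exists_differentiableOn_inverse isOpen_ball hUd hUi
  obtain ⟨KV, hKVd, hKV⟩ := exists_differentiableOn_inverse isOpen_ball hVd hVi
  have hUopen := isOpen_image_of_injOn isOpen_ball hUd hUi
  have h0b : (0 : ℂ) ∈ ball (0 : ℂ) 1 := by simp
  have hrUc : (rU : ℂ) ≠ 0 := by exact_mod_cast hrU.ne'
  have hrVc : (rV : ℂ) ≠ 0 := by exact_mod_cast hrV.ne'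
  have hKU' : HasDerivAt KU (rU : ℂ)⁻¹ 0 := by
    simpa [hU0, hUr] using
      hasDerivAt_inverse_of_injOn isOpen_ball hUd hUi hKUd hKU h0b (by rwa [hUr])
  have hKV' : HasDerivAt KV (rV : ℂ)⁻¹ 0 := by
    simpa [hV0, hVr] using
      hasDerivAt_inverse_of_injOn isOpen_ball hVd hVi hKVd hKV h0b (by rwa [hVr])
  have hφU' : HasDerivAt φU rU 0 := by
    rw [← hUr]
    exact (hUd.differentiableAt (isOpen_ball.mem_nhds h0b)).hasDerivAt
  have hφV' : HasDerivAt φV rV 0 := by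
    rw [← hVr]
    exact (hVd.differentiableAt (isOpen_ball.mem_nhds h0b)).hasDerivAt
  have hVmaps : MapsTo φV (ball 0 1) (φU '' ball 0 1) := fun z hz => by
    rw [hUim]
    exact hVU (hVim ▸ mem_image_of_mem φV hz)
  set g : ℂ → ℂ := KU ∘ φV with hg
  have hgd : DifferentiableOn ℂ g (ball 0 1) := hKUd.comp hVd hVmaps
  have hgV : ∀ z ∈ ball (0 : ℂ) 1, g z ∈ ball (0 : ℂ) 1 ∧ φU (g z) = φV z := by
    intro z hz
    obtain ⟨x, hx, hxz⟩ := hVmaps hz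
    rw [hg, Function.comp_apply, ← hxz, hKU x hx]
    exact ⟨hx, rfl⟩
  have hgi : InjOn g (ball 0 1) := fun z hz w hw h =>
    hVi hz hw (by rw [← (hgV z hz).2, ← (hgV w hw).2, h])
  have hKU0 : KU 0 = 0 := by simpa [hU0] using hKU 0 h0b
  have hKV0 : KV 0 = 0 := by simpa [hV0] using hKV 0 h0b
  have hg0 : g 0 = 0 := by simp [hg, hV0, hKU0]
  have hg' : ‖deriv g 0‖ = rV / rU := by
    have : HasDerivAt g ((rU : ℂ)⁻¹ * rV) 0 := HasDerivAt.comp 0 (by rwa [hV0]) hφV'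
    rw [this.deriv, norm_mul, norm_inv, Complex.norm_of_nonneg hrU.le,
      Complex.norm_of_nonneg hrV.le, inv_mul_eq_div]
  have hgm : MapsTo g (ball 0 1) (closedBall (g 0) 1) := fun z hz => by
    rw [hg0]
    exact ball_subset_closedBall (hgV z hz).1
  refine ⟨?_, ?_⟩
  · have hle := Complex.norm_deriv_le_one_of_mapsTo_ball hgd hgm one_pos
    rw [hg', div_le_one hrU] at hle
    refine sub_pos.2 (hle.lt_of_ne fun heq => hVneU (hVU.antisymm ?_))
    obtain ⟨C, hC, hCg⟩ := Complex.affine_of_mapsTo_ball_of_exists_norm_dslope_eq_div' hgd hgm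
      ⟨0, h0b, by rw [dslope_same, hg', heq, div_self hrU.ne', div_one]⟩
    rw [div_one] at hC
    have hC0 : C ≠ 0 := norm_pos_iff.1 (by rw [hC]; exact one_pos)
    rw [← hUim, ← hVim]
    rintro _ ⟨x, hx, rfl⟩
    have hxC : x / C ∈ ball (0 : ℂ) 1 := by simpa [hC] using hx
    refine ⟨x / C, hxC, ?_⟩
    rw [← (hgV _ hxC).2, hCg hxC]
    simp [hg0, hC0]
  · set q := Real.sqrt ε / Real.sqrt rU with hq
    have hsU : 0 < Real.sqrt rU := Real.sqrt_pos.2 hrU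
    have hsε : 0 < Real.sqrt ε := Real.sqrt_pos.2 hε
    have hq0 : 0 < q := div_pos hsε hsU
    have hq1 : rU * q = Real.sqrt rU * Real.sqrt ε := by
      rw [hq]
      nth_rw 1 [← Real.mul_self_sqrt hrU.le]
      field_simp
    have hq2 : rU * q ^ 2 = ε := by
      rw [hq, div_pow, Real.sq_sqrt hε.le, Real.sq_sqrt hrU.le]
      field_simp
    rw [mul_assoc, ← hq1]
    by_cases hρ : 1 - 4 * q ≤ 0
    · nlinarith
    push Not at hρ
    have hρ1 : ball (0 : ℂ) (1 - 4 * q) ⊆ ball 0 1 := ball_subset_ball (by linarith)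
    have hWopen := isOpen_image_of_injOn isOpen_ball hgd hgi
    have hsub : ball (0 : ℂ) (1 - 4 * q) ⊆ g '' ball 0 1 := by
      refine (convex_ball _ _).isPreconnected.subset_of_closure_inter_subset hWopen
        ⟨0, mem_ball_self hρ, 0, h0b, hg0⟩ ?_
      rintro z ⟨hzc, hz⟩
      by_contra hzW
      have hzb := hρ1 hz
      have hzV : φU z ∈ frontier V := by
        refine ⟨?_, fun h => ?_⟩
        · have hcl : φU z ∈ closure (φU '' (g '' ball 0 1)) :=
            (hUd.differentiableAt
              (isOpen_ball.mem_nhds hzb)).continuousAt.continuousWithinAt.mem_closure_image hzc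
          refine closure_mono ?_ hcl
          rintro _ ⟨_, ⟨y, hy, rfl⟩, rfl⟩
          rw [(hgV y hy).2, ← hVim]
          exact mem_image_of_mem φV hy
        · have h' := interior_subset h
          rw [← hVim] at h'
          obtain ⟨y, hy, hyz⟩ := h'
          refine hzW ⟨y, hy, hUi (hgV y hy).1 hzb ?_⟩
          rw [(hgV y hy).2, hyz]
      obtain ⟨w, hw, hzw⟩ := mem_thickening_iff.1 (hfr hzV)
      have hwU : w ∉ φU '' ball 0 1 := by
        rw [← hUim, hUopen.frontier_eq] at hw
        exact hw.2
      have hFd : DifferentiableOn ℂ (fun z => φU z - w) (ball 0 1) := hUd.sub_const w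
      have hFi : InjOn (fun z => φU z - w) (ball 0 1) := fun a ha b hb h =>
        hUi ha hb (sub_left_injective h)
      have hF0 : ∀ z ∈ ball (0 : ℂ) 1, φU z - w ≠ 0 := fun a ha h =>
        hwU ⟨a, ha, sub_eq_zero.1 h⟩
      have h1 := norm_deriv_zero_le_four_mul_norm hFd hFi hF0
      have h2 := le_norm_of_injOn_of_ne_zero hFd hFi hF0 hzb
      rw [deriv_sub_const, hUr, Complex.norm_of_nonneg hrU.le] at h1
      rw [← dist_eq_norm (φU z)] at h2
      have hz1 : ‖z‖ < 1 - 4 * q := by simpa using hz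
      have hz0 := norm_nonneg z
      have h3 : 2 * q ≤ (1 - ‖z‖) / (1 + ‖z‖) := by
        rw [le_div_iff₀ (by positivity)]
        nlinarith
      have h4 : (2 * q) ^ 2 ≤ ((1 - ‖z‖) / (1 + ‖z‖)) ^ 2 := pow_le_pow_left₀ (by positivity) h3 2
      have h5 : rU / 4 * (2 * q) ^ 2 ≤ ‖φU 0 - w‖ * ((1 - ‖z‖) / (1 + ‖z‖)) ^ 2 :=
        mul_le_mul (by linarith) h4 (by positivity) (norm_nonneg _)
      nlinarith
    have hUmaps : MapsTo φU (ball 0 (1 - 4 * q)) (φV '' ball 0 1) := by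
      intro z hz
      obtain ⟨y, hy, rfl⟩ := hsub hz
      rw [(hgV y hy).2]
      exact mem_image_of_mem φV hy
    have hkd : DifferentiableOn ℂ (KV ∘ φU) (ball 0 (1 - 4 * q)) :=
      hKVd.comp (hUd.mono hρ1) hUmaps
    have hkm : MapsTo (KV ∘ φU) (ball 0 (1 - 4 * q)) (closedBall ((KV ∘ φU) 0) 1) := by
      intro z hz
      obtain ⟨y, hy, hyz⟩ := hUmaps hz
      rw [Function.comp_apply, Function.comp_apply, ← hyz, hKV y hy, hU0, hKV0]
      exact ball_subset_closedBall hy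
    have hk := Complex.norm_deriv_le_div_of_mapsTo_ball hkd hkm hρ
    have hk' : HasDerivAt (KV ∘ φU) ((rV : ℂ)⁻¹ * rU) 0 :=
      HasDerivAt.comp 0 (by rwa [hU0]) hφU'
    rw [hk'.deriv, norm_mul, norm_inv, Complex.norm_of_nonneg hrU.le,
      Complex.norm_of_nonneg hrV.le, inv_mul_eq_div, div_le_div_iff₀ hrV hρ] at hk
    nlinarith
end

section
/- For every irrational θ ∈ (0,1), the Brjuno sum B(θ) = Σ_{n} log(q_{n+1})/q_n is finite if and only if Yoccoz's Brjuno function Φ(θ) = Σ_{n≥1} α_1(θ)⋯α_{n−1}(θ)·log(1/α_n(θ)) is finite. -/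
open scoped Real ENNReal
open Filter

/-- The Gauss-map iterates: `alphaIter θ k` is `α_{k+1}(θ)`, i.e. `alphaIter θ 0 = α_1(θ) = θ`
and `α_{i+1}(θ)` is the fractional part of `1/α_i(θ)`. -/
noncomputable def alphaIter (θ : ℝ) : ℕ → ℝ
  | 0 => θ
  | k + 1 => Int.fract (1 / alphaIter θ k)

/-- `HasCF θ a` : `θ` is an irrational number in `(0,1)` whose continued fraction digits
are given by `a` (0-indexed: `a k` is the digit `a_{k+1}` in 1-indexed notation). -/
def HasCF (θ : ℝ) (a : ℕ → ℕ) : Prop :=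
  θ ∈ Set.Ioo (0 : ℝ) 1 ∧ Irrational θ ∧ ∀ k, ⌊1 / alphaIter θ k⌋ = (a k : ℤ)

/-- Yoccoz's Brjuno function `Φ(θ) = Σ_{n≥1} α_1(θ)⋯α_{n-1}(θ)·log(1/α_n(θ))`,
as a real-valued sum. -/
noncomputable def brjunoPhi (θ : ℝ) : ℝ :=
  ∑' k : ℕ, (∏ j ∈ Finset.range k, alphaIter θ j) * Real.log (1 / alphaIter θ k)

/-- Yoccoz's Brjuno function with values in `ℝ≥0∞` (all terms are nonnegative). -/
noncomputable def brjunoPhiE (θ : ℝ) : ℝ≥0∞ :=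
  ∑' k : ℕ, ENNReal.ofReal ((∏ j ∈ Finset.range k, alphaIter θ j) * Real.log (1 / alphaIter θ k))

/-- Digits of the noble number `ω = [a_1,…,a_n,1,1,1,…]`. -/
def nobleDigits (n : ℕ) (a : ℕ → ℕ) : ℕ → ℕ := fun k => if k < n then a k else 1

/-- Digits of `β^N = [a_1,…,a_n,1,…,1,N,1,1,…]`, with `N` in (1-indexed) position `n+m`. -/
def betaDigits (n m N : ℕ) (a : ℕ → ℕ) : ℕ → ℕ :=
  fun k => if k + 1 = n + m then N else if k < n then a k else 1

/-- Digits of `β^I = [a_1,…,a_n,1,…,1,b_{n+m},b_{n+m+1},…]`: the digits of the noble number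
with the whole tail from (1-indexed) position `n+m` on replaced by the tail `b`. -/
def tailDigits (n m : ℕ) (a b : ℕ → ℕ) : ℕ → ℕ :=
  fun k => if k + 1 < n + m then (if k < n then a k else 1) else b k

/-- The continued fraction denominators `q_n` built from the digit sequence `a`
(0-indexed digits: `a 0 = a_1`): `q_0 = 1`, `q_1 = a_1`, `q_{n+1} = a_{n+1}·q_n + q_{n-1}`. -/
def qden (a : ℕ → ℕ) : ℕ → ℕ
  | 0 => 1
  | 1 => a 0
  | (k + 2) => a (k + 1) * qden a (k + 1) + qden a k

lemma ENNReal.tsum_ofReal_lt_top_iff_summable {f : ℕ → ℝ} (hf : ∀ k, 0 ≤ f k) :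
    ∑' k, ENNReal.ofReal (f k) < ⊤ ↔ Summable f := by
  refine ⟨fun h => ?_, fun h => h.tsum_ofReal_lt_top⟩
  simpa only [ENNReal.toReal_ofReal (hf _)] using ENNReal.summable_toReal h.ne

lemma alphaIter_irrational {θ : ℝ} (h : Irrational θ) (k : ℕ) : Irrational (alphaIter θ k) := by
  induction k with
  | zero => exact h
  | succ k ih =>
    rw [alphaIter, Int.fract, one_div]
    exact ih.inv.sub_intCast _

lemma alphaIter_mem_Ioo {θ : ℝ} (h : θ ∈ Set.Ioo (0 : ℝ) 1) (hi : Irrational θ) (k : ℕ) :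
    alphaIter θ k ∈ Set.Ioo (0 : ℝ) 1 := by
  cases k with
  | zero => exact h
  | succ k =>
    have hne : alphaIter θ (k + 1) ≠ 0 := (alphaIter_irrational hi (k + 1)).ne_zero
    rw [alphaIter] at hne ⊢
    exact ⟨lt_of_le_of_ne (Int.fract_nonneg _) hne.symm, Int.fract_lt_one _⟩

lemma HasCF.one_div_alphaIter {θ : ℝ} {a : ℕ → ℕ} (h : HasCF θ a) (k : ℕ) :
    1 / alphaIter θ k = a k + alphaIter θ (k + 1) := by
  rw [alphaIter, Int.fract, h.2.2 k]
  push_cast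
  ring

lemma HasCF.one_le_digit {θ : ℝ} {a : ℕ → ℕ} (h : HasCF θ a) (k : ℕ) : 1 ≤ a k := by
  have hk := alphaIter_mem_Ioo h.1 h.2.1 k
  have : (1 : ℤ) ≤ ⌊1 / alphaIter θ k⌋ :=
    Int.le_floor.2 (by push_cast; exact (one_le_div hk.1).2 hk.2.le)
  rw [h.2.2 k] at this
  exact_mod_cast this

/-- The product `α_1(θ)⋯α_k(θ)`. -/
noncomputable def alphaProd (θ : ℝ) (k : ℕ) : ℝ := ∏ j ∈ Finset.range k, alphaIter θ j

lemma alphaProd_succ (θ : ℝ) (k : ℕ) : alphaProd θ (k + 1) = alphaProd θ k * alphaIter θ k :=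
  Finset.prod_range_succ _ _

lemma alphaProd_pos {θ : ℝ} (h : θ ∈ Set.Ioo (0 : ℝ) 1) (hi : Irrational θ) (k : ℕ) :
    0 < alphaProd θ k :=
  Finset.prod_pos fun j _ => (alphaIter_mem_Ioo h hi j).1

lemma alphaProd_succ_le {θ : ℝ} (h : θ ∈ Set.Ioo (0 : ℝ) 1) (hi : Irrational θ) (k : ℕ) :
    alphaProd θ (k + 1) ≤ alphaProd θ k := by
  rw [alphaProd_succ]
  exact mul_le_of_le_one_right (alphaProd_pos h hi k).le (alphaIter_mem_Ioo h hi k).2.le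

lemma HasCF.alphaProd_eq {θ : ℝ} {a : ℕ → ℕ} (h : HasCF θ a) (k : ℕ) :
    alphaProd θ k = a k * alphaProd θ (k + 1) + alphaProd θ (k + 2) := by
  have hk := (alphaIter_mem_Ioo h.1 h.2.1 k).1
  have key : alphaIter θ k * (a k + alphaIter θ (k + 1)) = 1 := by
    rw [← h.one_div_alphaIter k, mul_one_div_cancel hk.ne']
  rw [alphaProd_succ θ (k + 1), alphaProd_succ θ k]
  linear_combination -alphaProd θ k * key

lemma HasCF.qden_mul_alphaProd_add {θ : ℝ} {a : ℕ → ℕ} (h : HasCF θ a) (k : ℕ) :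
    qden a (k + 1) * alphaProd θ (k + 1) + qden a k * alphaProd θ (k + 2) = 1 := by
  induction k with
  | zero =>
    have := h.alphaProd_eq 0
    simp only [alphaProd, Finset.range_zero, Finset.prod_empty] at this
    simp only [qden, alphaProd, Nat.cast_one, one_mul]
    exact this.symm
  | succ k ih =>
    rw [← ih, h.alphaProd_eq (k + 1), qden]
    push_cast
    ring

section Denominators

variable {a : ℕ → ℕ}

lemma qden_pos (ha : ∀ k, 1 ≤ a k) : ∀ k, 0 < qden a k
  | 0 => by simp [qden]
  | 1 => ha 0
  | k + 2 => by
    rw [qden]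
    exact Nat.add_pos_right _ (qden_pos ha k)

lemma qden_le_succ (ha : ∀ k, 1 ≤ a k) : ∀ k, qden a k ≤ qden a (k + 1)
  | 0 => ha 0
  | k + 1 => by
    rw [qden]
    nlinarith [ha (k + 1), qden_pos ha (k + 1)]

lemma two_pow_le_two_mul_qden_sq (ha : ∀ k, 1 ≤ a k) : ∀ k, 2 ^ k ≤ 2 * qden a k ^ 2
  | 0 => by simp [qden]
  | 1 => by
    have := ha 0
    simp only [qden]
    nlinarith
  | k + 2 => by
    have hle : 2 * qden a k ≤ qden a (k + 2) := by
      rw [qden]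
      nlinarith [ha (k + 1), qden_le_succ ha k, qden_pos ha (k + 1)]
    have := two_pow_le_two_mul_qden_sq ha k
    calc 2 ^ (k + 2) = 4 * 2 ^ k := by ring
      _ ≤ 2 * (2 * qden a k) ^ 2 := by linarith
      _ ≤ 2 * qden a (k + 2) ^ 2 := by gcongr

lemma summable_inv_sqrt_qden (ha : ∀ k, 1 ≤ a k) : Summable fun k => 1 / √(qden a k : ℝ) := by
  set r : ℝ := √√(1 / 2) with hr
  have hr0 : 0 ≤ r := Real.sqrt_nonneg _
  have hr4 : r ^ 4 = 1 / 2 := by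
    rw [show r ^ 4 = (r ^ 2) ^ 2 by ring, hr, Real.sq_sqrt (Real.sqrt_nonneg _),
      Real.sq_sqrt (by norm_num)]
  have hr1 : r < 1 := by
    by_contra! hle
    have := one_le_pow₀ hle (n := 4)
    norm_num [hr4] at this
  refine Summable.of_nonneg_of_le (fun k => by positivity) (fun k => ?_)
    ((summable_geometric_of_lt_one hr0 hr1).mul_left 2)
  have hq : (0 : ℝ) < qden a k := by exact_mod_cast qden_pos ha k
  have hle : (2 : ℝ) ^ k ≤ 2 * (qden a k : ℝ) ^ 2 := by
    exact_mod_cast two_pow_le_two_mul_qden_sq ha k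
  refine le_of_pow_le_pow_left₀ (n := 4) (by norm_num) (by positivity) ?_
  have hs : √(qden a k : ℝ) ^ 4 = (qden a k : ℝ) ^ 2 := by
    rw [show √(qden a k : ℝ) ^ 4 = (√(qden a k : ℝ) ^ 2) ^ 2 by ring, Real.sq_sqrt hq.le]
  rw [div_pow, hs, mul_pow, ← pow_mul, mul_comm k 4, pow_mul, hr4, div_pow, one_pow, one_pow,
    mul_one_div, div_le_div_iff₀ (by positivity) (by positivity)]
  nlinarith [sq_nonneg (qden a k : ℝ)]

lemma summable_log_two_mul_qden_div (ha : ∀ k, 1 ≤ a k) :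
    Summable fun k => Real.log (2 * qden a k) / (qden a k : ℝ) := by
  have hq (k) : (1 : ℝ) ≤ qden a k := by exact_mod_cast qden_pos ha k
  refine Summable.of_nonneg_of_le
    (fun k => div_nonneg (Real.log_nonneg (by linarith [hq k])) (by linarith [hq k]))
    (fun k => ?_) ((summable_inv_sqrt_qden ha).mul_left 2)
  have hk := hq k
  have hs : 0 < √(qden a k : ℝ) := Real.sqrt_pos.2 (by linarith)
  have hsq : √(qden a k : ℝ) ^ 2 = qden a k := Real.sq_sqrt (by linarith)
  have hlog : Real.log (2 * qden a k) ≤ 2 * √(qden a k : ℝ) := by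
    have h1 := Real.log_le_sub_one_of_pos hs
    rw [Real.log_sqrt (by linarith)] at h1
    rw [Real.log_mul (by norm_num) (by linarith)]
    linarith [Real.log_two_lt_d9]
  calc Real.log (2 * qden a k) / (qden a k : ℝ) ≤ 2 * √(qden a k : ℝ) / √(qden a k : ℝ) ^ 2 := by
        rw [hsq]; gcongr
    _ = 2 * (1 / √(qden a k : ℝ)) := by field_simp

end Denominators

lemma HasCF.qden_mul_alphaProd_le_one {θ : ℝ} {a : ℕ → ℕ} (h : HasCF θ a) (k : ℕ) :
    qden a k * alphaProd θ k ≤ 1 := by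
  cases k with
  | zero => simp [qden, alphaProd]
  | succ k =>
    have := h.qden_mul_alphaProd_add k
    have : 0 ≤ qden a k * alphaProd θ (k + 2) :=
      mul_nonneg (Nat.cast_nonneg _) (alphaProd_pos h.1 h.2.1 _).le
    linarith

lemma HasCF.one_le_two_mul_qden_mul_alphaProd {θ : ℝ} {a : ℕ → ℕ} (h : HasCF θ a) (k : ℕ) :
    1 ≤ 2 * (qden a k * alphaProd θ k) := by
  cases k with
  | zero => simp [qden, alphaProd]
  | succ k =>
    have := h.qden_mul_alphaProd_add k
    have hq : (qden a k : ℝ) ≤ qden a (k + 1) := by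
      exact_mod_cast qden_le_succ h.one_le_digit k
    have : qden a k * alphaProd θ (k + 2) ≤ qden a (k + 1) * alphaProd θ (k + 1) :=
      mul_le_mul hq (alphaProd_succ_le h.1 h.2.1 _) (alphaProd_pos h.1 h.2.1 _).le
        (Nat.cast_nonneg _)
    linarith

/-- `B(θ) = Σ_n log(q_{n+1})/q_n` is finite if and only if Yoccoz's Brjuno function
`Φ(θ)` is finite. -/
theorem brjuno_sum_finite_iff_phi_finite
    (θ : ℝ) (a : ℕ → ℕ) (hθ : HasCF θ a) :
    (∑' k : ℕ, ENNReal.ofReal (Real.log (qden a (k + 1)) / qden a k)) < ⊤ ↔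
      brjunoPhiE θ < ⊤ := by
  have hq (k) : (1 : ℝ) ≤ qden a k := by exact_mod_cast qden_pos hθ.one_le_digit k
  have hA (k) := alphaProd_pos hθ.1 hθ.2.1 k
  have hα (k) := alphaIter_mem_Ioo hθ.1 hθ.2.1 k
  have hub (k) := hθ.qden_mul_alphaProd_le_one k
  have hlb (k) := hθ.one_le_two_mul_qden_mul_alphaProd k
  have hAle (k) : alphaProd θ k ≤ 1 / qden a k := by
    rw [le_div_iff₀ (by linarith [hq k]), mul_comm]
    exact hub k
  have hleA (k) : 1 / qden a k ≤ 2 * alphaProd θ k := by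
    rw [div_le_iff₀ (by linarith [hq k])]
    linarith [hlb k]
  have hB0 (k) : 0 ≤ Real.log (qden a (k + 1)) / qden a k :=
    div_nonneg (Real.log_nonneg (hq _)) (by linarith [hq k])
  have hlog0 (k) : 0 ≤ Real.log (1 / alphaIter θ k) :=
    Real.log_nonneg ((one_le_div (hα k).1).2 (hα k).2.le)
  have hΦ0 (k) : 0 ≤ alphaProd θ k * Real.log (1 / alphaIter θ k) :=
    mul_nonneg (hA k).le (hlog0 k)
  have hsum := summable_log_two_mul_qden_div hθ.one_le_digit
  have hle_two_mul (k) : 1 / alphaIter θ k ≤ 2 * qden a (k + 1) := by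
    have h1 := hlb (k + 1)
    rw [alphaProd_succ] at h1
    have hA1 : alphaProd θ k ≤ 1 := (hAle k).trans
      ((div_le_one (by linarith [hq k])).2 (hq k))
    rw [div_le_iff₀ (hα k).1]
    have : qden a (k + 1) * alphaIter θ k * alphaProd θ k ≤ qden a (k + 1) * alphaIter θ k :=
      mul_le_of_le_one_right (mul_nonneg (by linarith [hq (k + 1)]) (hα k).1.le) hA1
    linarith
  have hqden_le (k) : (qden a (k + 1) : ℝ) ≤ 2 * qden a k * (1 / alphaIter θ k) := by
    have h1 := hub (k + 1)
    rw [alphaProd_succ] at h1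
    rw [mul_one_div, le_div_iff₀ (hα k).1]
    have h3 : 0 < qden a (k + 1) * alphaIter θ k :=
      mul_pos (by linarith [hq (k + 1)]) (hα k).1
    nlinarith [hlb k, hq k, hA k]
  rw [ENNReal.tsum_ofReal_lt_top_iff_summable hB0]
  refine Iff.trans ?_ (ENNReal.tsum_ofReal_lt_top_iff_summable hΦ0).symm
  constructor
  · intro h
    refine Summable.of_nonneg_of_le hΦ0 (fun k => ?_) (h.add hsum)
    have hl := Real.log_le_log (one_div_pos.2 (hα k).1) (hle_two_mul k)
    rw [Real.log_mul (by norm_num) (by linarith [hq (k + 1)])] at hl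
    have h2 : Real.log 2 ≤ Real.log (2 * qden a k) :=
      Real.log_le_log (by norm_num) (by linarith [hq k])
    calc alphaProd θ k * Real.log (1 / alphaIter θ k)
        ≤ 1 / qden a k * Real.log (1 / alphaIter θ k) :=
          mul_le_mul_of_nonneg_right (hAle k) (hlog0 k)
      _ ≤ 1 / qden a k * (Real.log (qden a (k + 1)) + Real.log (2 * qden a k)) := by
          gcongr
          linarith
      _ = _ := by ring
  · intro h
    refine Summable.of_nonneg_of_le hB0 (fun k => ?_) ((h.mul_left 2).add hsum)
    have hl := Real.log_le_log (by linarith [hq (k + 1)]) (hqden_le k)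
    rw [Real.log_mul (by linarith [hq k]) (one_div_pos.2 (hα k).1).ne'] at hl
    calc Real.log (qden a (k + 1)) / qden a k
        ≤ (Real.log (2 * qden a k) + Real.log (1 / alphaIter θ k)) / qden a k := by gcongr
      _ = 1 / qden a k * Real.log (1 / alphaIter θ k) + Real.log (2 * qden a k) / qden a k := by
          ring
      _ ≤ 2 * alphaProd θ k * Real.log (1 / alphaIter θ k)
          + Real.log (2 * qden a k) / qden a k :=
          add_le_add (mul_le_mul_of_nonneg_right (hleA k) (hlog0 k)) le_rfl
      _ = _ := by ring
end
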